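/- arXiv:2302.06495 — 6 statements merged into one kernel-verified Lean document; each statement's English description precedes it below -/
import Mathlib

section
/- Fix an integer K ≥ 1 and define the Brier-type Bregman score s(p,q) = Σ_{k=1}^K [(q_k − p_k)·2q_k − (q_k² − 1/K)] for p, q in the probability simplex Δ_K. Then for every p ∈ Δ_K, sup_{q ∈ Δ_K} s(p,q) = 2 − 2·min_{k} p_k. Consequently the function p ↦ sup_{q ∈ Δ_K} s(p,q) attains its infimum over Δ_K exactly at the uniform distribution p = (1/K,…,1/K), and the minimax value equals 2 − 2/K. -/
/-- The Brier-type Bregman score in expanded form. -/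
theorem brier_score_expand {K : ℕ} (hK : 1 ≤ K) (p q : Fin K → ℝ) :
    ∑ k, ((q k - p k) * (2 * q k) - ((q k) ^ 2 - 1 / (K : ℝ))) =
      ∑ k, (q k) ^ 2 - 2 * ∑ k, p k * q k + 1 := by
  have hK' : (K : ℝ) ≠ 0 := by positivity
  have hone : ∑ _k : Fin K, 1 / (K : ℝ) = 1 := by simp [hK']
  conv_rhs => rw [← hone, Finset.mul_sum, ← Finset.sum_sub_distrib, ← Finset.sum_add_distrib]
  exact Finset.sum_congr rfl fun k _ => by ring

/-- On the simplex the sum of squares is at most one. -/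
theorem sum_sq_le_one_of_simplex {ι : Type*} [Fintype ι] {q : ι → ℝ}
    (hq : ∀ k, 0 ≤ q k) (hq1 : ∑ k, q k = 1) : ∑ k, (q k) ^ 2 ≤ 1 := by
  rw [← hq1]
  refine Finset.sum_le_sum fun k _ => ?_
  have hk : q k ≤ 1 := hq1 ▸ Finset.single_le_sum (fun i _ => hq i) (Finset.mem_univ k)
  nlinarith [hq k]

/-- A weighted average is at least the minimum. -/
theorem iInf_le_sum_mul_of_simplex {ι : Type*} [Fintype ι] (p : ι → ℝ) {q : ι → ℝ}
    (hq : ∀ k, 0 ≤ q k) (hq1 : ∑ k, q k = 1) : ⨅ k, p k ≤ ∑ k, p k * q k := by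
  calc ⨅ k, p k = ∑ k, (⨅ i, p i) * q k := by rw [← Finset.mul_sum, hq1, mul_one]
    _ ≤ ∑ k, p k * q k := Finset.sum_le_sum fun k _ =>
      mul_le_mul_of_nonneg_right (ciInf_le (Set.finite_range p).bddBelow k) (hq k)

/-- The minimum coordinate of a vector with coordinate sum one is at most `1 / K`. -/
theorem iInf_le_one_div_of_sum_eq_one {K : ℕ} (hK : 1 ≤ K) {p : Fin K → ℝ}
    (hp : ∑ k, p k = 1) : ⨅ k, p k ≤ 1 / (K : ℝ) := by
  have hK' : (0 : ℝ) < K := by positivity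
  have h : ∑ _k : Fin K, (⨅ i, p i) ≤ ∑ k, p k :=
    Finset.sum_le_sum fun k _ => ciInf_le (Set.finite_range p).bddBelow k
  rw [hp, Finset.sum_const, Finset.card_univ, Fintype.card_fin, nsmul_eq_mul] at h
  rw [le_div_iff₀ hK']
  linarith

/-- If the minimum coordinate is `1 / K` and the coordinates sum to one, the vector is uniform. -/
theorem eq_uniform_of_iInf_eq {K : ℕ} (hK : 1 ≤ K) {p : Fin K → ℝ}
    (hp : ∑ k, p k = 1) (hinf : ⨅ k, p k = 1 / (K : ℝ)) : p = fun _ => 1 / (K : ℝ) := by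
  have hK' : (K : ℝ) ≠ 0 := by positivity
  have hle : ∀ k ∈ Finset.univ, 1 / (K : ℝ) ≤ p k := fun k _ =>
    hinf ▸ ciInf_le (Set.finite_range p).bddBelow k
  have hsum : ∑ _k : Fin K, 1 / (K : ℝ) = ∑ k, p k := by simp [hp, hK']
  funext k
  exact ((Finset.sum_eq_sum_iff_of_le hle).1 hsum k (Finset.mem_univ k)).symm

/-- The uniform distribution is the minimax solution for the Brier-type Bregman score:
for `p` in the probability simplex, `sup_{q ∈ Δ} s(p,q) = 2 - 2 · min_k p_k` (and the
supremum is attained), the function `p ↦ sup_q s(p,q)` attains its least value `2 - 2/K`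
over the simplex, and this least value is attained exactly at the uniform distribution. -/
theorem minimax_brier_uniform (K : ℕ) (hK : 1 ≤ K)
    (Δ : Set (Fin K → ℝ)) (hΔ : Δ = {p | (∀ k, 0 ≤ p k) ∧ ∑ k, p k = 1})
    (s : (Fin K → ℝ) → (Fin K → ℝ) → ℝ)
    (hs : ∀ p q, s p q = ∑ k, ((q k - p k) * (2 * q k) - ((q k) ^ 2 - 1 / (K : ℝ)))) :
    (∀ p ∈ Δ, IsGreatest (s p '' Δ) (2 - 2 * ⨅ k, p k)) ∧
    IsLeast ((fun p => sSup (s p '' Δ)) '' Δ) (2 - 2 / (K : ℝ)) ∧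
    (∀ p ∈ Δ, sSup (s p '' Δ) = 2 - 2 / (K : ℝ) → p = fun _ => (1 / (K : ℝ))) := by
  have hne : Nonempty (Fin K) := ⟨⟨0, hK⟩⟩
  have hK' : (K : ℝ) ≠ 0 := by positivity
  subst hΔ
  simp only [brier_score_expand hK] at hs
  have hmax : ∀ p ∈ {p : Fin K → ℝ | (∀ k, 0 ≤ p k) ∧ ∑ k, p k = 1},
      IsGreatest (s p '' {p | (∀ k, 0 ≤ p k) ∧ ∑ k, p k = 1}) (2 - 2 * ⨅ k, p k) := by
    intro p _
    constructor
    · obtain ⟨j, hj⟩ := exists_eq_ciInf_of_finite (f := p)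
      refine ⟨Pi.single j 1, ⟨fun k => ?_, by simp⟩, ?_⟩
      · by_cases h : k = j
        · subst h; simp
        · simp [h]
      · rw [hs, ← hj]
        simp [Pi.single_apply]
        ring
    · rintro _ ⟨q, ⟨hq, hq1⟩, rfl⟩
      rw [hs]
      linarith [sum_sq_le_one_of_simplex hq hq1, iInf_le_sum_mul_of_simplex p hq hq1]
  refine ⟨hmax, ⟨⟨fun _ => 1 / (K : ℝ), ?_, ?_⟩, ?_⟩, ?_⟩
  · exact ⟨fun _ => by positivity, by simp [hK']⟩
  · have hu := (hmax (fun _ => 1 / (K : ℝ)) ⟨fun _ => by positivity, by simp [hK']⟩).csSup_eq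
    simp only [hu, ciInf_const]
    ring
  · rintro _ ⟨p, hp, rfl⟩
    have h := iInf_le_one_div_of_sum_eq_one hK hp.2
    simp only [(hmax p hp).csSup_eq]
    rw [show 2 / (K : ℝ) = 2 * (1 / K) by ring]
    linarith
  · intro p hp h
    rw [(hmax p hp).csSup_eq, show 2 / (K : ℝ) = 2 * (1 / K) by ring] at h
    exact eq_uniform_of_iInf_eq hK hp.2 (by linarith)
end

section
/- Fix an integer K ≥ 2 and a vector b ∈ ℝ^K whose coordinates are not all equal. Define F(a) = H(σ(a·b)) where σ is the softmax and H is the Shannon entropy, i.e., F(a) = −Σ_{i=1}^K [exp(a b_i)/Σ_j exp(a b_j)] · log[exp(a b_i)/Σ_j exp(a b_j)]. Then F is strictly decreasing on the interval (0, 1]: for all 0 < a₁ < a₂ ≤ 1, F(a₂) < F(a₁). -/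
open Finset

/-- The strict Cauchy-Schwarz inequality `(∑ wᵢ bᵢ)² < (∑ wᵢ bᵢ²) (∑ wᵢ)` for positive weights `w`
and a non-constant family `b`. -/
theorem sq_sum_mul_lt_sum_mul_sum {ι : Type*} [Fintype ι] {w b : ι → ℝ}
    (hw : ∀ i, 0 < w i) (hb : ∃ i j, b i ≠ b j) :
    (∑ i, w i * b i) ^ 2 < (∑ i, w i * b i ^ 2) * ∑ i, w i := by
  obtain ⟨i, j, hij⟩ := hb
  set Z := ∑ i, w i with hZ
  set M := ∑ i, w i * b i with hM
  set S := ∑ i, w i * b i ^ 2 with hS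
  have hZpos : 0 < Z := sum_pos (fun k _ => hw k) ⟨i, mem_univ i⟩
  have expand : ∑ k, w k * (Z * b k - M) ^ 2 = Z * (S * Z - M ^ 2) := by
    have : ∀ k, w k * (Z * b k - M) ^ 2 =
        Z ^ 2 * (w k * b k ^ 2) - 2 * Z * M * (w k * b k) + M ^ 2 * w k := fun k => by ring
    simp only [this, sum_add_distrib, sum_sub_distrib, ← mul_sum, ← hZ, ← hM, ← hS]
    ring
  have pos : 0 < ∑ k, w k * (Z * b k - M) ^ 2 := by
    obtain ⟨k, hk⟩ : ∃ k, Z * b k - M ≠ 0 := by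
      by_contra! h
      exact hij (mul_left_cancel₀ hZpos.ne' (by linarith [h i, h j]))
    exact sum_pos' (fun l _ => mul_nonneg (hw l).le (sq_nonneg _))
      ⟨k, mem_univ k, mul_pos (hw k) (by positivity)⟩
  rw [expand] at pos
  exact sub_pos.1 (pos_of_mul_pos_right pos hZpos.le)

theorem hasDerivAt_sum_exp_mul {ι : Type*} [Fintype ι] (b c : ι → ℝ) (a : ℝ) :
    HasDerivAt (fun a => ∑ i, Real.exp (a * b i) * c i)
      (∑ i, Real.exp (a * b i) * (b i * c i)) a := by
  refine HasDerivAt.fun_sum fun i _ => ?_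
  refine ((((hasDerivAt_id' a).mul_const (b i)).exp).mul_const (c i)).congr_deriv ?_
  ring

theorem sum_exp_mul_pos {ι : Type*} [Fintype ι] [Nonempty ι] (b : ι → ℝ) (a : ℝ) :
    0 < ∑ i, Real.exp (a * b i) :=
  sum_pos (fun _ _ => Real.exp_pos _) univ_nonempty

/-- The entropy of a softmax, in terms of the partition function and the mean logit. -/
theorem entropy_softmax_eq {ι : Type*} [Fintype ι] [Nonempty ι] (b : ι → ℝ) (a : ℝ) :
    -∑ i, (Real.exp (a * b i) / ∑ j, Real.exp (a * b j)) *
        Real.log (Real.exp (a * b i) / ∑ j, Real.exp (a * b j)) =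
      Real.log (∑ i, Real.exp (a * b i)) -
        a * ((∑ i, Real.exp (a * b i) * b i) / ∑ i, Real.exp (a * b i)) := by
  set Z := ∑ i, Real.exp (a * b i) with hZ
  have hZ0 : Z ≠ 0 := (sum_exp_mul_pos b a).ne'
  have : ∀ i, Real.exp (a * b i) / Z * Real.log (Real.exp (a * b i) / Z) =
      a / Z * (Real.exp (a * b i) * b i) - Real.log Z / Z * Real.exp (a * b i) := fun i => by
    rw [Real.log_div (Real.exp_ne_zero _) hZ0, Real.log_exp]
    ring
  simp only [this, sum_sub_distrib, ← mul_sum, ← hZ]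
  field_simp
  ring

/-- The entropy of a softmax has derivative `-a` times the variance of the logits with respect to
the scaling factor `a`. -/
theorem hasDerivAt_entropy_softmax {ι : Type*} [Fintype ι] [Nonempty ι] (b : ι → ℝ) (a : ℝ) :
    HasDerivAt (fun a => -∑ i, (Real.exp (a * b i) / ∑ j, Real.exp (a * b j)) *
        Real.log (Real.exp (a * b i) / ∑ j, Real.exp (a * b j)))
      (-(a * (((∑ i, Real.exp (a * b i) * b i ^ 2) * ∑ i, Real.exp (a * b i)) -
        (∑ i, Real.exp (a * b i) * b i) ^ 2) / (∑ i, Real.exp (a * b i)) ^ 2)) a := by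
  simp only [entropy_softmax_eq]
  have hZ : HasDerivAt (fun a => ∑ i, Real.exp (a * b i)) (∑ i, Real.exp (a * b i) * b i) a := by
    simpa using hasDerivAt_sum_exp_mul b (fun _ => 1) a
  have hM : HasDerivAt (fun a => ∑ i, Real.exp (a * b i) * b i)
      (∑ i, Real.exp (a * b i) * b i ^ 2) a := by
    simpa only [sq] using hasDerivAt_sum_exp_mul b b a
  have hZ0 := (sum_exp_mul_pos b a).ne'
  refine ((hZ.log hZ0).fun_sub ((hasDerivAt_id' a).fun_mul (hM.fun_div hZ hZ0))).congr_deriv ?_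
  field_simp
  ring


/-- Part (3) of the proof of Proposition 1 (Distance awareness): for logits `b` that are not
all equal, the Shannon entropy of the softmax of the scaled logits `a • b` is strictly
decreasing in the scaling factor `a` on the interval `(0, 1]`. -/
theorem entropy_softmax_strictAnti (K : ℕ) (hK : 2 ≤ K) (b : Fin K → ℝ)
    (hb : ∃ i j, b i ≠ b j)
    (F : ℝ → ℝ)
    (hF : ∀ a, F a = -∑ i : Fin K,
        (Real.exp (a * b i) / ∑ j : Fin K, Real.exp (a * b j)) *
          Real.log (Real.exp (a * b i) / ∑ j : Fin K, Real.exp (a * b j))) :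
    StrictAntiOn F (Set.Ioc (0 : ℝ) 1) := by
  have : Nonempty (Fin K) := ⟨hb.choose⟩
  obtain rfl : F = _ := funext hF
  refine strictAntiOn_of_deriv_neg (convex_Ioc 0 1)
    (fun a _ => (hasDerivAt_entropy_softmax b a).continuousAt.continuousWithinAt) fun a ha => ?_
  rw [interior_Ioc] at ha
  rw [(hasDerivAt_entropy_softmax b a).deriv, neg_lt_zero]
  exact div_pos (mul_pos ha.1 (sub_pos.2
    (sq_sum_mul_lt_sum_mul_sum (fun i => Real.exp_pos (a * b i)) hb)))
    (pow_pos (sum_exp_mul_pos b a) 2)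
end

section
/- Fix an integer K ≥ 1 and any vector b ∈ ℝ^K. The Shannon entropy of the softmax of the scaled logits a·b tends to log K as a → 0⁺: lim_{a→0⁺} H(σ(a·b)) = log K, which is the maximal possible entropy of a probability distribution on K outcomes. -/
open Filter Topology

/-- Part (2) of the proof of Proposition 1 (Distance awareness): the Shannon entropy of the
softmax of the scaled logits `a • b` tends to `log K`, the maximal entropy on `K` outcomes,
as the scaling factor `a` tends to `0⁺`. -/
theorem entropy_softmax_tendsto_log (K : ℕ) (hK : 1 ≤ K) (b : Fin K → ℝ) :
    Tendsto (fun a : ℝ => -∑ i : Fin K,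
        (Real.exp (a * b i) / ∑ j : Fin K, Real.exp (a * b j)) *
          Real.log (Real.exp (a * b i) / ∑ j : Fin K, Real.exp (a * b j)))
      (nhdsWithin 0 (Set.Ioi 0)) (nhds (Real.log K)) := by
  have : NeZero K := ⟨by omega⟩
  have hK_pos : (0 : ℝ) < K := by exact_mod_cast hK
  have h_sum_ne : ∀ a : ℝ, ∑ j : Fin K, Real.exp (a * b j) ≠ 0 := fun a =>
    (Finset.sum_pos (fun j _ => Real.exp_pos _) Finset.univ_nonempty).ne'
  have h_softmax : ∀ i : Fin K,
      Continuous fun a : ℝ => Real.exp (a * b i) / ∑ j : Fin K, Real.exp (a * b j) :=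
    fun i => Continuous.div (by fun_prop) (by fun_prop) h_sum_ne
  have h_entropy : Continuous fun a : ℝ => -∑ i : Fin K,
      (Real.exp (a * b i) / ∑ j : Fin K, Real.exp (a * b j)) *
        Real.log (Real.exp (a * b i) / ∑ j : Fin K, Real.exp (a * b j)) :=
    (continuous_finsetSum Finset.univ fun i _ =>
      Real.continuous_mul_log.comp (h_softmax i)).neg
  refine (h_entropy.tendsto' 0 _ ?_).mono_left nhdsWithin_le_nhds
  simp [hK_pos.ne']
end

section
/- Fix an integer K ≥ 1, a vector u ∈ ℝ^K, and a scalar c with 0 < c ≤ 1. Then the maximal softmax probability does not increase under scaling the logits by c: max_{i∈{1,…,K}} σ(c·u)_i ≤ max_{i∈{1,…,K}} σ(u)_i, where σ is the softmax. -/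
/-- Confidence-reduction step in the proof of Proposition 2: scaling the logits by a factor
`c ∈ (0, 1]` does not increase the maximal softmax probability (the model's confidence). -/
theorem softmax_scaling_confidence_le (K : ℕ) (hK : 1 ≤ K) (u : Fin K → ℝ)
    (c : ℝ) (hc0 : 0 < c) (hc1 : c ≤ 1) :
    (⨆ i : Fin K, Real.exp (c * u i) / ∑ j : Fin K, Real.exp (c * u j)) ≤
      ⨆ i : Fin K, Real.exp (u i) / ∑ j : Fin K, Real.exp (u j) := by
  have : Nonempty (Fin K) := ⟨⟨0, hK⟩⟩
  obtain ⟨m, hm⟩ := Finite.exists_max u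
  have sum_pos (v : Fin K → ℝ) : 0 < ∑ j, Real.exp (v j) :=
    Finset.sum_pos (fun j _ => Real.exp_pos (v j)) Finset.univ_nonempty
  refine ciSup_le fun i => le_trans ?_
    (le_ciSup (f := fun i => Real.exp (u i) / ∑ j, Real.exp (u j))
      (Set.finite_range _).bddAbove m)
  rw [div_le_div_iff₀ (sum_pos fun j => c * u j) (sum_pos u), Finset.mul_sum, Finset.mul_sum]
  refine Finset.sum_le_sum fun j _ => ?_
  rw [← Real.exp_add, ← Real.exp_add, Real.exp_le_exp]
  nlinarith [mul_le_mul_of_nonneg_left (hm i) hc0.le,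
    mul_le_mul_of_nonneg_left (hm j) (sub_nonneg.2 hc1)]
end

section
/- Fix integers K ≥ 1, N ≥ 1, M ≥ 1. Let samples i ∈ {1,…,N} have logit vectors u_i ∈ ℝ^K, each with a unique maximizing coordinate, labels y_i ∈ {1,…,K}, and scaling factors p_i ∈ (0,1]; let B_1,…,B_M be a partition of {1,…,N} into nonempty bins. Define for each bin: acc(B_m) = (1/|B_m|) Σ_{i∈B_m} 1[argmax_k (u_i)_k = y_i], conf(B_m) = (1/|B_m|) Σ_{i∈B_m} max_k σ(u_i)_k, and conf'(B_m) = (1/|B_m|) Σ_{i∈B_m} max_k σ(p_i·u_i)_k, where σ is the softmax. Then: (i) the per-bin accuracy of the scaled predictions equals acc(B_m), since argmax_k (p_i u_i)_k = argmax_k (u_i)_k for each i; (ii) conf'(B_m) ≤ conf(B_m) for every m; and (iii) if moreover acc(B_m) ≤ conf'(B_m) for every m, then the expected calibration error of the scaled predictor is no larger than that of the standard softmax: Σ_{m=1}^M (|B_m|/N)·|acc(B_m) − conf'(B_m)| ≤ Σ_{m=1}^M (|B_m|/N)·|acc(B_m) − conf(B_m)|. -/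
/-- Scaling a vector by a factor in `[0, 1]` does not increase any softmax coordinate beyond the
softmax coordinate at a maximizer of the unscaled vector. -/
theorem exp_mul_div_sum_le {ι : Type*} [Fintype ι] [Nonempty ι] {t : ℝ} (ht₀ : 0 ≤ t)
    (ht₁ : t ≤ 1) {v : ι → ℝ} {c : ι} (hc : ∀ j, v j ≤ v c) (k : ι) :
    Real.exp (t * v k) / ∑ j, Real.exp (t * v j) ≤ Real.exp (v c) / ∑ j, Real.exp (v j) := by
  have sum_exp_pos (w : ι → ℝ) : 0 < ∑ j, Real.exp (w j) :=
    Finset.sum_pos (fun j _ => Real.exp_pos _) Finset.univ_nonempty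
  rw [div_le_div_iff₀ (sum_exp_pos _) (sum_exp_pos _), Finset.mul_sum, Finset.mul_sum]
  refine Finset.sum_le_sum fun j _ => ?_
  rw [← Real.exp_add, ← Real.exp_add, Real.exp_le_exp]
  have hk : t * v k ≤ t * v c := mul_le_mul_of_nonneg_left (hc k) ht₀
  have hj : t * (v c - v j) ≤ v c - v j := mul_le_of_le_one_left (sub_nonneg.2 (hc j)) ht₁
  linarith


/-- Proposition 2 (Reducing over-confidence of the standard softmax).
Samples `i` have logit vectors `u i` with a unique maximizing coordinate `c i`, labels
`y i`, and scaling factors `p i ∈ (0,1]`; the bins `B 1, …, B M` partition the samples.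
Then (i) the argmax of the scaled logits `p i • u i` coincides with the argmax `c i` of the
unscaled logits, so any argmax selector for the scaled logits yields the same per-bin
accuracy; (ii) the per-bin confidence of the scaled predictor is at most that of the
standard softmax; and (iii) if the standard scaled predictor is still over-confident on
every bin (`acc ≤ conf'`), then the expected calibration error of the scaled predictor is
at most that of the standard softmax. -/
theorem density_softmax_reduces_ece (K N M : ℕ) (hK : 1 ≤ K) (hN : 1 ≤ N) (hM : 1 ≤ M)
    (u : Fin N → Fin K → ℝ) (y : Fin N → Fin K) (p : Fin N → ℝ)
    (hp : ∀ i, p i ∈ Set.Ioc (0 : ℝ) 1)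
    (c : Fin N → Fin K)
    (hc : ∀ i, ∀ j, j ≠ c i → u i j < u i (c i))
    (B : Fin M → Finset (Fin N)) (hBne : ∀ m, (B m).Nonempty)
    (hBdisj : ∀ m m', m ≠ m' → Disjoint (B m) (B m'))
    (hBcover : ∀ i, ∃ m, i ∈ B m)
    (σ : (Fin K → ℝ) → Fin K → ℝ)
    (hσ : ∀ v i, σ v i = Real.exp (v i) / ∑ j : Fin K, Real.exp (v j))
    (acc conf conf' : Fin M → ℝ)
    (hacc : ∀ m, acc m =
      (∑ i ∈ B m, if c i = y i then (1 : ℝ) else 0) / (B m).card)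
    (hconf : ∀ m, conf m = (∑ i ∈ B m, ⨆ k : Fin K, σ (u i) k) / (B m).card)
    (hconf' : ∀ m, conf' m =
      (∑ i ∈ B m, ⨆ k : Fin K, σ (fun k => p i * u i k) k) / (B m).card) :
    -- (i) argmax is unchanged by positive scaling, hence per-bin accuracy is unchanged
    ((∀ i, {j : Fin K | ∀ k, p i * u i k ≤ p i * u i j} = {c i}) ∧
      (∀ c' : Fin N → Fin K, (∀ i, ∀ j, j ≠ c' i → p i * u i j < p i * u i (c' i)) →
        ∀ m, (∑ i ∈ B m, if c' i = y i then (1 : ℝ) else 0) / (B m).card = acc m)) ∧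
    -- (ii) confidence does not increase
    (∀ m, conf' m ≤ conf m) ∧
    -- (iii) if the scaled predictor is still over-confident on every bin, ECE decreases
    ((∀ m, acc m ≤ conf' m) →
      ∑ m : Fin M, ((B m).card / (N : ℝ)) * |acc m - conf' m| ≤
        ∑ m : Fin M, ((B m).card / (N : ℝ)) * |acc m - conf m|) := by
  have hmax : ∀ i j, u i j ≤ u i (c i) := fun i j => by
    rcases eq_or_ne j (c i) with rfl | h
    exacts [le_rfl, (hc i j h).le]
  have hconf_le : ∀ m, conf' m ≤ conf m := fun m => by
    rw [hconf, hconf']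
    refine div_le_div_of_nonneg_right (Finset.sum_le_sum fun i _ => ?_) (Nat.cast_nonneg _)
    have : Nonempty (Fin K) := ⟨c i⟩
    refine ciSup_le fun k => ?_
    refine le_trans ?_ (le_ciSup (Set.finite_range _).bddAbove (c i))
    simpa only [hσ] using exp_mul_div_sum_le (hp i).1.le (hp i).2 (hmax i) k
  refine ⟨⟨fun i => ?_, fun c' hc' m => ?_⟩, hconf_le, fun hle => ?_⟩
  · ext j
    simp only [Set.mem_ofPred_eq, Set.mem_singleton_iff]
    refine ⟨fun h => ?_, ?_⟩
    · by_contra hj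
      exact (hc i j hj).not_ge (le_of_mul_le_mul_left (h (c i)) (hp i).1)
    · rintro rfl k
      exact mul_le_mul_of_nonneg_left (hmax i k) (hp i).1.le
  · have hcc : c' = c := funext fun i => by
      by_contra h
      exact (hc' i (c i) (Ne.symm h)).not_ge
        (mul_le_mul_of_nonneg_left (hmax i (c' i)) (hp i).1.le)
    rw [hacc, hcc]
  · refine Finset.sum_le_sum fun m _ => mul_le_mul_of_nonneg_left ?_ (by positivity)
    rw [abs_sub_comm, abs_of_nonneg (sub_nonneg.2 (hle m)), abs_sub_comm,
      abs_of_nonneg (sub_nonneg.2 ((hle m).trans (hconf_le m)))]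
    exact sub_le_sub_right (hconf_le m) _
end

section
/- Fix an integer K ≥ 1, a vector u ∈ ℝ^K, and a scalar a with 0 < a ≤ 1. Then the Shannon entropy of the softmax of the scaled logits is at least that of the unscaled softmax: H(σ(a·u)) ≥ H(σ(u)), where σ is the softmax and H is the Shannon entropy. -/
/-- The Gibbs inequality for positive vectors of equal total mass. -/
theorem sum_mul_log_le_sum_mul_log_self {ι : Type*} [Fintype ι] {p q : ι → ℝ}
    (hp : ∀ i, 0 < p i) (hq : ∀ i, 0 < q i) (hpq : ∑ i, q i = ∑ i, p i) :
    ∑ i, p i * Real.log (q i) ≤ ∑ i, p i * Real.log (p i) := by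
  have h : ∑ i, (p i * Real.log (q i) - p i * Real.log (p i)) ≤ ∑ i, (q i - p i) := by
    refine Finset.sum_le_sum fun i _ => ?_
    have h1 := Real.log_le_sub_one_of_pos (div_pos (hq i) (hp i))
    rw [Real.log_div (hq i).ne' (hp i).ne'] at h1
    have h2 := mul_le_mul_of_nonneg_left h1 (hp i).le
    have h3 : p i * (q i / p i) = q i := mul_div_cancel₀ _ (hp i).ne'
    linarith
  rw [Finset.sum_sub_distrib, Finset.sum_sub_distrib, hpq] at h
  linarith


/-- Distance-awareness consequence in the proof of Proposition 1: scaling the logits by a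
factor `a ∈ (0, 1]` can only increase the Shannon entropy of the softmax prediction. -/
theorem entropy_softmax_scaling_ge (K : ℕ) (hK : 1 ≤ K) (u : Fin K → ℝ)
    (a : ℝ) (ha0 : 0 < a) (ha1 : a ≤ 1) :
    (-∑ i : Fin K, (Real.exp (u i) / ∑ j : Fin K, Real.exp (u j)) *
        Real.log (Real.exp (u i) / ∑ j : Fin K, Real.exp (u j))) ≤
      -∑ i : Fin K, (Real.exp (a * u i) / ∑ j : Fin K, Real.exp (a * u j)) *
        Real.log (Real.exp (a * u i) / ∑ j : Fin K, Real.exp (a * u j)) := by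
  have : Nonempty (Fin K) := ⟨⟨0, hK⟩⟩
  have hpos (v : Fin K → ℝ) : 0 < ∑ j, Real.exp (v j) :=
    Finset.sum_pos (fun j _ => Real.exp_pos _) Finset.univ_nonempty
  have hlog (v : Fin K → ℝ) (i : Fin K) :
      Real.log (Real.exp (v i) / ∑ j, Real.exp (v j)) =
        v i - Real.log (∑ j, Real.exp (v j)) := by
    rw [Real.log_div (Real.exp_pos _).ne' (hpos v).ne', Real.log_exp]
  have hsum (v : Fin K → ℝ) : ∑ i, Real.exp (v i) / ∑ j, Real.exp (v j) = 1 := by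
    rw [← Finset.sum_div, div_self (hpos v).ne']
  have hp (v : Fin K → ℝ) (i : Fin K) : 0 < Real.exp (v i) / ∑ j, Real.exp (v j) :=
    div_pos (Real.exp_pos _) (hpos v)
  rcases ha1.eq_or_lt with rfl | ha
  · simp
  have hpq := sum_mul_log_le_sum_mul_log_self (hp u) (hp fun i => a * u i)
    ((hsum fun i => a * u i).trans (hsum u).symm)
  have hqp := sum_mul_log_le_sum_mul_log_self (hp fun i => a * u i) (hp u)
    ((hsum u).trans (hsum fun i => a * u i).symm)
  have hsu := hsum u
  have hsa := hsum fun i => a * u i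
  have hla := hlog fun i => a * u i
  simp only [hlog u, hla] at hpq hqp ⊢
  set p : Fin K → ℝ := fun i => Real.exp (u i) / ∑ j, Real.exp (u j)
  set q : Fin K → ℝ := fun i => Real.exp (a * u i) / ∑ j, Real.exp (a * u j)
  set L := Real.log (∑ j, Real.exp (u j))
  set M := Real.log (∑ j, Real.exp (a * u j))
  have expand (r : Fin K → ℝ) (hr : ∑ i, r i = 1) (b c : ℝ) :
      ∑ i, r i * (b * u i - c) = b * ∑ i, r i * u i - c := by
    simp only [mul_sub, Finset.sum_sub_distrib, ← Finset.sum_mul, hr, one_mul, Finset.mul_sum,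
      mul_left_comm]
  have hpL := expand p hsu 1 L
  have hpM := expand p hsu a M
  have hqL := expand q hsa 1 L
  have hqM := expand q hsa a M
  simp only [one_mul] at hpL hqL
  change ∑ i, p i * (a * u i - M) ≤ ∑ i, p i * (u i - L) at hpq
  change ∑ i, q i * (u i - L) ≤ ∑ i, q i * (a * u i - M) at hqp
  change -∑ i, p i * (u i - L) ≤ -∑ i, q i * (a * u i - M)
  rw [hpL, hpM] at hpq
  rw [hqL, hqM] at hqp
  rw [hpL, hqM]
  have hmean : ∑ i, q i * u i ≤ ∑ i, p i * u i := by
    by_contra! hlt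
    nlinarith [mul_pos (sub_pos.2 ha) (sub_pos.2 hlt)]
  linarith [mul_le_mul_of_nonneg_left hmean ha0.le]
end
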